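/- arXiv:2511.00582 — 8 statements merged into one kernel-verified Lean document; each statement's English description precedes it below -/
import Mathlib

section
/- Let G be a connected undirected graph, n0 a distinguished root node, and T a spanning tree of G. Orient every edge of T away from the root n0. Let e = (n,m) be an oriented edge of T (with head m) and let e' = (n',m) be an edge of G not in T with the same head m. Then the spanning subgraph T' = T + e' - e obtained by replacing e with e' is again a spanning tree of G (rooted at n0) if and only if the node n' is not downward of the edge e in T. -/
open SimpleGraph

/-- `T` is a spanning tree of `G`: a subgraph of `G` (on the full node set) that is
connected and contains no cycles, i.e. is a tree. -/
def IsSpanningTreeOf {V : Type*} (G T : SimpleGraph V) : Prop :=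
  T ≤ G ∧ T.IsTree

/-- In the tree `T` rooted at `n0`, a node `u` is *downward* of the edge `e` if every
path in `T` from the root `n0` to `u` uses the edge `e` (in a tree the path is unique). -/
def Downward {V : Type*} (T : SimpleGraph V) (n0 : V) (e : Sym2 V) (u : V) : Prop :=
  ∀ p : T.Walk n0 u, p.IsPath → e ∈ p.edges

/-- `(n, m)` is an edge of `T` oriented away from the root `n0`, with tail `n` and
head `m`; i.e. the edge is present in `T` and its head `m` lies downward of it. -/
def OrientedEdge {V : Type*} (T : SimpleGraph V) (n0 : V) (n m : V) : Prop :=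
  T.Adj n m ∧ Downward T n0 s(n, m) m

/-- The spanning subgraph `T + e' - e` obtained from `T` by replacing the edge
`e = {n, m}` with the edge `e' = {n', m}`. -/
def rotate {V : Type*} (T : SimpleGraph V) (n m n' : V) : SimpleGraph V :=
  T.deleteEdges {s(n, m)} ⊔ SimpleGraph.fromEdgeSet {s(n', m)}

/-- A node is downward of `e` exactly when deleting `e` separates it from the root. -/
theorem downward_iff_not_reachable_deleteEdges {V : Type*} (T : SimpleGraph V) (n0 : V)
    (e : Sym2 V) (u : V) :
    Downward T n0 e u ↔ ¬ (T.deleteEdges {e}).Reachable n0 u := by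
  constructor
  · intro h hr
    obtain ⟨p, hp⟩ := hr.exists_isPath
    have he := h (p.mapLe (T.deleteEdges_le {e})) (hp.mapLe _)
    rw [Walk.edges_mapLe_eq_edges] at he
    simpa using p.edges_subset_edgeSet he
  · intro h p _
    by_contra he
    exact h ⟨p.toDeleteEdge e he⟩

/-- Deleting an edge of a connected graph leaves every node connected to one of its ends. -/
theorem SimpleGraph.Connected.reachable_deleteEdges_or {V : Type*} {T : SimpleGraph V}
    (hT : T.Connected) (n m u : V) :
    (T.deleteEdges {s(n, m)}).Reachable u n ∨ (T.deleteEdges {s(n, m)}).Reachable u m := by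
  obtain ⟨p⟩ := hT.preconnected u n
  induction p with
  | nil => exact Or.inl .rfl
  | @cons a b c hab p ih =>
    by_cases hs : s(a, b) = s(c, m)
    · rcases Sym2.eq_iff.mp hs with ⟨rfl, rfl⟩ | ⟨rfl, rfl⟩
      · exact Or.inl .rfl
      · exact Or.inr .rfl
    · have hadj : (T.deleteEdges {s(c, m)}).Adj a b := by
        rw [deleteEdges_adj]
        exact ⟨hab, hs⟩
      exact ih.imp hadj.reachable.trans hadj.reachable.trans

/-- For a spanning tree `T` of a connected graph `G` rooted at `n0`,
an oriented edge `e = (n, m)` of `T` and an edge `e' = {n', m}` of `G` not in `T` with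
the same head `m`, the subgraph `T + e' - e` is again a spanning tree of `G` if and
only if `n'` is not downward of `e` in `T`. -/
theorem stmt0 {V : Type*} (G T : SimpleGraph V) (n0 n m n' : V)
    (hG : G.Connected) (hT : IsSpanningTreeOf G T)
    (he : OrientedEdge T n0 n m)
    (he' : G.Adj n' m) (he'T : ¬ T.Adj n' m) :
    IsSpanningTreeOf G (rotate T n m n') ↔ ¬ Downward T n0 s(n, m) n' := by
  obtain ⟨hTG, hTc, hTa⟩ := hT
  obtain ⟨-, hm⟩ := he
  rw [downward_iff_not_reachable_deleteEdges] at hm ⊢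
  rw [not_not, IsSpanningTreeOf, rotate]
  have hsplit := hTc.reachable_deleteEdges_or n m
  set D := T.deleteEdges {s(n, m)}
  have hDT : D ≤ T := T.deleteEdges_le _
  have hn : D.Reachable n0 n := (hsplit n0).resolve_right hm
  constructor
  · rintro ⟨-, -, hacyc⟩
    have hnot : ¬ D.Reachable n' m := fun hr =>
      ((isAcyclic_sup_fromEdgeSet_iff.mp hacyc).2 hr).elim he'.ne fun h => he'T (hDT h)
    exact hn.trans ((hsplit n').resolve_right hnot).symm
  · intro hr
    have hle : D ≤ D ⊔ fromEdgeSet {s(n', m)} := le_sup_left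
    have hadj : (D ⊔ fromEdgeSet {s(n', m)}).Adj n' m :=
      Or.inr ((fromEdgeSet_adj _).mpr ⟨rfl, he'.ne⟩)
    have hto (u : V) : (D ⊔ fromEdgeSet {s(n', m)}).Reachable u n' := by
      rcases hsplit u with hu | hu
      · exact (hu.trans (hn.symm.trans hr)).mono hle
      · exact (hu.mono hle).trans hadj.reachable.symm
    refine ⟨sup_le (hDT.trans hTG) ?_, ?_, ?_⟩
    · intro a b hab
      exact (adj_congr_of_sym2 G ((fromEdgeSet_adj _).mp hab).1).mpr he'
    · exact (connected_iff_exists_forall_reachable _).mpr ⟨n', fun u => (hto u).symm⟩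
    · exact isAcyclic_sup_fromEdgeSet_iff.mpr
        ⟨hTa.anti hDT, fun h => (hm (hr.trans h)).elim⟩
end

section
/- Let G be a connected undirected graph with root node n0, let T be a spanning tree of G rooted at n0 (edges oriented away from the root), and let r: e = (n,m) -> e' = (n',m) be a valid edge rotation of T, i.e., e is in T, e' is in G but not in T, both have head m, and n' is not downward of e in T. Then the reverse rotation e' -> e is a valid edge rotation of the spanning tree T' = T + e' - e; that is, e' lies in T', e lies in G but not in T', both have head m, and n is not downward of e' in T'. -/
open SimpleGraph

theorem reachable_deleteEdges_or_of_walk {V : Type*} {T : SimpleGraph V} (n m : V) {a b : V}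
    (p : T.Walk a b) :
    (T.deleteEdges {s(n, m)}).Reachable a b ∨ (T.deleteEdges {s(n, m)}).Reachable a n ∨
      (T.deleteEdges {s(n, m)}).Reachable a m := by
  induction p with
  | nil => exact .inl .rfl
  | @cons a c b h p ih =>
    by_cases hac : s(a, c) = s(n, m)
    · rcases Sym2.eq_iff.1 hac with ⟨rfl, -⟩ | ⟨rfl, -⟩
      · exact .inr (.inl .rfl)
      · exact .inr (.inr .rfl)
    · have hr : (T.deleteEdges {s(n, m)}).Reachable a c :=
        Adj.reachable (by simpa [deleteEdges_adj] using ⟨h, by simpa using hac⟩)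
      exact ih.imp hr.trans (Or.imp hr.trans hr.trans)

theorem rotate_deleteEdges {V : Type*} {T : SimpleGraph V} {n m n' : V} (h : ¬ T.Adj n' m) :
    (rotate T n m n').deleteEdges {s(n', m)} = T.deleteEdges {s(n, m)} := by
  ext a b
  have : s(a, b) = s(n', m) → ¬ T.Adj a b := by
    intro hab
    rwa [← mem_edgeSet, hab]
  simp only [rotate, deleteEdges_adj, sup_adj, fromEdgeSet_adj, Set.mem_singleton_iff]
  tauto

/-- If `r : e = (n,m) → e' = (n',m)` is a valid edge rotation of the
spanning tree `T` of `G` rooted at `n0`, then the reverse rotation `e' → e` is a valid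
edge rotation of `T' = T + e' - e`: `e'` lies in `T'`, `e` lies in `G` but not in `T'`,
both have head `m` (in particular `e'` is an oriented edge of `T'` with head `m`), and
`n` is not downward of `e'` in `T'`. -/
theorem stmt1 {V : Type*} (G T : SimpleGraph V) (n0 n m n' : V)
    (hG : G.Connected) (hT : IsSpanningTreeOf G T)
    (he : OrientedEdge T n0 n m)
    (he' : G.Adj n' m) (he'T : ¬ T.Adj n' m)
    (hvalid : ¬ Downward T n0 s(n, m) n') :
    (rotate T n m n').Adj n' m ∧
    G.Adj n m ∧ ¬ (rotate T n m n').Adj n m ∧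
    OrientedEdge (rotate T n m n') n0 n' m ∧
    ¬ Downward (rotate T n m n') n0 s(n', m) n := by
  have hnm := he.1
  have hD := (downward_iff_not_reachable_deleteEdges ..).1 he.2
  have hadj : (rotate T n m n').Adj n' m := by
    simp [rotate, he'.ne]
  have hn : (T.deleteEdges {s(n, m)}).Reachable n0 n := by
    obtain ⟨p⟩ := hT.2.connected n0 m
    have := reachable_deleteEdges_or_of_walk n m p
    tauto
  refine ⟨hadj, hT.1 hnm, ?_, ⟨hadj, ?_⟩, ?_⟩
  · have hne : n ≠ n' := by
      rintro rfl
      exact he'T hnm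
    simp [rotate, hne, hnm.ne]
  · rwa [downward_iff_not_reachable_deleteEdges, rotate_deleteEdges he'T]
  · rwa [downward_iff_not_reachable_deleteEdges, rotate_deleteEdges he'T, not_not]
end

section
/- Let G be a connected undirected graph and fix a root node n0. Then, starting from any spanning tree T of G rooted at n0, any other spanning tree T' of G rooted at n0 can be reached by a finite sequence of valid edge rotations, where each intermediate configuration is a spanning tree rooted at n0. -/
open SimpleGraph

/-- `T'` is obtained from `T` by one valid edge rotation (relative to the ambient
graph `G` and root `n0`). -/
def ValidRotation {V : Type*} (G : SimpleGraph V) (n0 : V) (T T' : SimpleGraph V) : Prop :=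
  ∃ n m n', OrientedEdge T n0 n m ∧ G.Adj n' m ∧ ¬ T.Adj n' m ∧
    ¬ Downward T n0 s(n, m) n' ∧ T' = rotate T n m n'

/-- Deleting an edge at a vertex that is not reachable from `u` does not affect the vertices
reachable from `u`. -/
lemma SimpleGraph.Reachable.deleteEdges_of_not_reachable {V : Type*} {R : SimpleGraph V}
    {u v n m : V} (hv : R.Reachable u v) (hm : ¬ R.Reachable u m) :
    (R.deleteEdges {s(n, m)}).Reachable u v := by
  classical
  obtain ⟨p⟩ := hv
  refine ⟨p.toDeleteEdges _ fun e he h ↦ hm ?_⟩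
  rw [Set.mem_singleton_iff.1 h] at he
  exact ⟨p.takeUntil m (p.snd_mem_support_of_mem_edges he)⟩

lemma downward_iff_not_reachable {V : Type*} {T : SimpleGraph V} {n0 u : V} {e : Sym2 V} :
    Downward T n0 e u ↔ ¬ (T.deleteEdges {e}).Reachable n0 u := by
  classical
  constructor
  · rintro h hr
    obtain ⟨q, hq⟩ := hr.exists_isPath
    have he := h (q.mapLe (deleteEdges_le _)) (hq.mapLe _)
    rw [Walk.edges_mapLe_eq_edges] at he
    simpa using q.edges_subset_edgeSet he
  · intro h p _
    by_contra hp
    exact h ⟨p.toDeleteEdge e hp⟩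

/-- Every vertex `m` other than `n0` reachable from `n0` has a parent, which remains reachable
from `n0` after deleting the edge to `m`. -/
lemma SimpleGraph.Reachable.exists_adj_reachable_deleteEdges {V : Type*} {T : SimpleGraph V}
    {n0 m : V} (h : T.Reachable n0 m) (hne : m ≠ n0) :
    ∃ n, T.Adj n m ∧ (T.deleteEdges {s(n, m)}).Reachable n0 n := by
  obtain ⟨q, hq⟩ := h.symm.exists_isPath
  cases q with
  | nil => exact absurd rfl hne
  | @cons _ n _ hadj q =>
    rw [Walk.cons_isPath_iff] at hq
    exact ⟨n, hadj.symm, Reachable.symm ⟨q.toDeleteEdge _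
      fun he ↦ hq.2 (q.snd_mem_support_of_mem_edges he)⟩⟩

lemma SimpleGraph.IsTree.not_reachable_deleteEdges {V : Type*} {T : SimpleGraph V} {n0 n m : V}
    (hT : T.IsTree) (hadj : T.Adj n m) (hn : (T.deleteEdges {s(n, m)}).Reachable n0 n) :
    ¬ (T.deleteEdges {s(n, m)}).Reachable n0 m := fun hm ↦
  isBridge_iff.1 (isAcyclic_iff_forall_adj_isBridge.1 hT.isAcyclic hadj) (hn.symm.trans hm)

lemma SimpleGraph.IsTree.rotate {V : Type*} {T : SimpleGraph V} {n0 n m n' : V} (hT : T.IsTree)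
    (hadj : T.Adj n m) (hn : (T.deleteEdges {s(n, m)}).Reachable n0 n)
    (hn' : (T.deleteEdges {s(n, m)}).Reachable n0 n') : (rotate T n m n').IsTree := by
  have hm := hT.not_reachable_deleteEdges hadj hn
  have hle : T.deleteEdges {s(n, m)} ≤ _root_.rotate T n m n' := le_sup_left
  have hnm : (_root_.rotate T n m n').Reachable n0 m := by
    refine (hn'.mono hle).trans (Adj.reachable (Or.inr ?_))
    rw [fromEdgeSet_adj]
    exact ⟨rfl, fun h ↦ hm (h ▸ hn')⟩
  have hall (v : V) : (_root_.rotate T n m n').Reachable n0 v := by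
    by_contra hv
    obtain ⟨p⟩ := hT.connected n0 v
    obtain ⟨d, -, h1, h2⟩ :=
      p.exists_boundary_dart {v | (_root_.rotate T n m n').Reachable n0 v} .rfl hv
    by_cases hd : s(d.fst, d.snd) = s(n, m)
    · obtain ⟨-, h⟩ | ⟨-, h⟩ := Sym2.eq_iff.1 hd
      · exact h2 (by simpa [h] using hnm)
      · exact h2 (by simpa [h] using hn.mono hle)
    · refine h2 (Reachable.trans h1 (Adj.reachable (hle ?_)))
      rw [deleteEdges_adj]
      exact ⟨d.adj, hd⟩
  have : Nonempty V := ⟨n0⟩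
  exact ⟨⟨fun u v ↦ (hall u).symm.trans (hall v)⟩, IsAcyclic.sup_edge_of_not_reachable
    (fun h ↦ hm (hn'.trans h)) (hT.isAcyclic.anti (deleteEdges_le _))⟩

/-- If `T ≠ T'`, some valid rotation of `T` enlarges the set of nodes connected to the root
by edges common to both trees. -/
lemma exists_validRotation_reachable_ssubset {V : Type*} {G T T' : SimpleGraph V} {n0 : V}
    (hT : IsSpanningTreeOf G T) (hT' : IsSpanningTreeOf G T') (hne : T ≠ T') :
    ∃ T₁, ValidRotation G n0 T T₁ ∧ IsSpanningTreeOf G T₁ ∧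
      {v | (T ⊓ T').Reachable n0 v} ⊂ {v | (T₁ ⊓ T').Reachable n0 v} := by
  obtain ⟨v, hv⟩ : ∃ v, ¬ (T ⊓ T').Reachable n0 v := by
    by_contra! hall
    have : Nonempty V := ⟨n0⟩
    have hc : (T ⊓ T').Connected := ⟨fun u v ↦ (hall u).symm.trans (hall v)⟩
    exact hne (le_antisymm
      (((isTree_iff_minimal_connected.1 hT.2).2 hc inf_le_left).trans inf_le_right)
      (((isTree_iff_minimal_connected.1 hT'.2).2 hc inf_le_right).trans inf_le_left))
  obtain ⟨p⟩ := hT'.2.connected n0 v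
  obtain ⟨⟨⟨n', m⟩, hadj'⟩, -, hn'S, hmS⟩ :=
    p.exists_boundary_dart {v | (T ⊓ T').Reachable n0 v} .rfl hv
  change (T ⊓ T').Reachable n0 n' at hn'S
  change ¬ (T ⊓ T').Reachable n0 m at hmS
  change T'.Adj n' m at hadj'
  have hnT : ¬ T.Adj n' m := fun h ↦ hmS (hn'S.trans (Adj.reachable ⟨h, hadj'⟩))
  obtain ⟨n, hadj, hn⟩ := (hT.2.connected n0 m).exists_adj_reachable_deleteEdges
    (fun h ↦ hmS (h ▸ .rfl))
  have hn' : (T.deleteEdges {s(n, m)}).Reachable n0 n' :=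
    (hn'S.deleteEdges_of_not_reachable hmS).mono (deleteEdges_mono inf_le_left)
  have hle : (T ⊓ T').deleteEdges {s(n, m)} ≤ rotate T n m n' ⊓ T' :=
    le_inf ((deleteEdges_mono inf_le_left).trans le_sup_left)
      ((deleteEdges_le _).trans inf_le_right)
  have hsub {v : V} (hv : (T ⊓ T').Reachable n0 v) : (rotate T n m n' ⊓ T').Reachable n0 v :=
    (hv.deleteEdges_of_not_reachable hmS).mono hle
  have hrot : (rotate T n m n').Adj n' m := Or.inr ((fromEdgeSet_adj _).2 ⟨rfl, hadj'.ne⟩)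
  refine ⟨rotate T n m n', ⟨n, m, n',
    ⟨hadj, downward_iff_not_reachable.2 (hT.2.not_reachable_deleteEdges hadj hn)⟩,
    hT'.1 hadj', hnT, fun h ↦ downward_iff_not_reachable.1 h hn', rfl⟩,
    ⟨sup_le ((deleteEdges_le _).trans hT.1) ?_, hT.2.rotate hadj hn hn'⟩,
    Set.ssubset_iff_of_subset (fun _ ↦ hsub) |>.2
      ⟨m, (hsub hn'S).trans (Adj.reachable ⟨hrot, hadj'⟩), hmS⟩⟩
  exact (edge_le_iff _).2 (.inr (hT'.1 hadj'))

/-- For a connected graph `G` with root `n0`, any spanning tree `T'`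
of `G` rooted at `n0` can be reached from any spanning tree `T` rooted at `n0` by a
finite sequence of valid edge rotations. -/
theorem stmt3 {V : Type*} [Fintype V] (G : SimpleGraph V) (n0 : V)
    (hconn : G.Connected) (T T' : SimpleGraph V)
    (hT : IsSpanningTreeOf G T) (hT' : IsSpanningTreeOf G T') :
    Relation.ReflTransGen (ValidRotation G n0) T T' := by
  induction hS : {v | (T ⊓ T').Reachable n0 v} using WellFoundedGT.induction generalizing T with
  | ind S ih =>
    by_cases hne : T = T'
    · rw [hne]
    · obtain ⟨T₁, hrot, hT₁, hlt⟩ := exists_validRotation_reachable_ssubset hT hT' hne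
      exact .head hrot (ih _ (hS ▸ hlt) T₁ hT₁ rfl)
end

section
/- Let G be a connected undirected graph with root node n0, and let T and T' be two spanning trees of G rooted at n0. Let N(T,T') denote the number of edge mismatches, i.e., the number of oriented edges of T (oriented away from the root) that do not occur as oriented edges of T' (oriented away from the root). Then T can be reconfigured into T' by a sequence of exactly N(T,T') valid edge rotations, each intermediate configuration being a spanning tree rooted at n0. -/
open SimpleGraph

/-- The number of edge mismatches `N(T,T')`: the number of oriented edges (pairs
tail/head, oriented away from the root `n0`) of `T` that are not oriented edges of
`T'`. -/
noncomputable def mismatches {V : Type*} [Fintype V]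
    (T T' : SimpleGraph V) (n0 : V) : ℕ :=
  {p : V × V | OrientedEdge T n0 p.1 p.2 ∧ ¬ OrientedEdge T' n0 p.1 p.2}.ncard

/-- `p` is the parent function of `T` with root `n0`: it fixes the root, its iterates
send every node to the root, and the edges of `T` join each node to its parent. -/
structure IsParentFun {V : Type*} (T : SimpleGraph V) (n0 : V) (p : V → V) : Prop where
  root : p n0 = n0
  reach : ∀ u, ∃ k, p^[k] u = n0
  adj : ∀ a b, T.Adj a b ↔ a ≠ b ∧ (b = p a ∨ a = p b)

theorem IsSpanningTreeOf.exists_isParentFun {V : Type*} {G T : SimpleGraph V}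
    (hT : IsSpanningTreeOf G T) (n0 : V) : ∃ p, IsParentFun T n0 p := by
  have hac := hT.2.isAcyclic
  choose f hf hf' using fun u => hT.2.existsUnique_path n0 u
  have hnil : f n0 = Walk.nil := (hf' n0 _ Walk.IsPath.nil).symm
  refine ⟨fun u => (f u).penultimate, ?_, ?_, ?_⟩
  · simp [hnil]
  · suffices H : ∀ n u, (f u).length = n → ∃ k, (fun u => (f u).penultimate)^[k] u = n0 from
      fun u => H _ u rfl
    intro n
    induction n with
    | zero => exact fun u hu => ⟨0, (Walk.eq_of_length_eq_zero hu).symm⟩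
    | succ n ih =>
      intro u hu
      have hnn : ¬ (f u).Nil := by
        rw [← Walk.length_eq_zero_iff]; omega
      have hdrop : (f u).dropLast = f (f u).penultimate := hf' _ _ (hf u).dropLast
      have hlen : (f (f u).penultimate).length = n := by
        rw [← hdrop]
        have := congrArg Walk.length (Walk.concat_dropLast (p := f u) (Walk.adj_penultimate hnn))
        rw [Walk.length_concat] at this
        omega
      obtain ⟨k, hk⟩ := ih _ hlen
      exact ⟨k + 1, by rw [Function.iterate_succ_apply]; exact hk⟩
  · have key : ∀ u, u ≠ n0 → T.Adj (f u).penultimate u := fun u hu =>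
      Walk.adj_penultimate (Walk.not_nil_of_ne hu.symm)
    have hroot : (f n0).penultimate = n0 := by simp [hnil]
    intro a b
    constructor
    · intro h
      refine ⟨h.ne, ?_⟩
      by_cases hb : b ∈ (f a).support
      · exact Or.inl (hac.eq_penultimate_of_adj_end (hf a) h hb)
      · exact Or.inr (hac.eq_penultimate_of_adj_end (hf b) h.symm
          (hac.mem_support_of_ne_mem_support_of_adj_of_isPath (hf b) (hf a) h.symm hb))
    · rintro ⟨hne, h | h⟩
      · have ha : a ≠ n0 := by
          rintro rfl
          exact hne (h.trans hroot).symm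
        have := key a ha
        rw [← h] at this
        exact this.symm
      · have hb : b ≠ n0 := by
          rintro rfl
          exact hne (h.trans hroot)
        have := key b hb
        rwa [← h] at this

namespace IsParentFun

variable {V : Type*} {T : SimpleGraph V} {n0 : V} {p : V → V}

theorem iterate_root (h : IsParentFun T n0 p) (k : ℕ) : p^[k] n0 = n0 :=
  Function.iterate_fixed h.root k

theorem eq_root_of_iterate_eq (h : IsParentFun T n0 p) {k : ℕ} {u : V}
    (hu : p^[k + 1] u = u) : u = n0 := by
  obtain ⟨j, hj⟩ := h.reach u
  have h1 : p^[(k + 1) * j] u = u := by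
    rw [Function.iterate_mul]
    exact Function.iterate_fixed hu j
  have h2 : p^[(k + 1) * j] u = n0 := by
    rw [show (k + 1) * j = k * j + j by ring, Function.iterate_add_apply, hj, h.iterate_root]
  exact h1.symm.trans h2

theorem parent_ne (h : IsParentFun T n0 p) {m : V} (hm : m ≠ n0) : p m ≠ m :=
  fun hp => hm (h.eq_root_of_iterate_eq (k := 0) hp)

theorem downward_iff (h : IsParentFun T n0 p) {m : V} (hm : m ≠ n0) (u : V) :
    Downward T n0 s(p m, m) u ↔ ∃ k, p^[k] u = m := by
  classical
  constructor
  · intro hd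
    by_contra hu
    suffices H : ∀ k u, p^[k] u = n0 → (¬ ∃ k, p^[k] u = m) →
        ∃ w : T.Walk n0 u, s(p m, m) ∉ w.edges by
      obtain ⟨k, hk⟩ := h.reach u
      obtain ⟨w, hw⟩ := H k u hk hu
      exact hw (w.edges_bypass_subset_edges (hd _ w.bypass_isPath))
    intro k
    induction k with
    | zero =>
      intro u hu _
      obtain rfl : u = n0 := hu
      exact ⟨Walk.nil, by simp⟩
    | succ k ih =>
      intro u hk hu
      by_cases hroot : u = n0
      · subst hroot
        exact ⟨Walk.nil, by simp⟩
      have hpu : ¬ ∃ k, p^[k] (p u) = m := fun ⟨j, hj⟩ => hu ⟨j + 1, hj⟩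
      obtain ⟨w, hw⟩ := ih (p u) hk hpu
      have hadj : T.Adj (p u) u := (h.adj _ _).2 ⟨h.parent_ne hroot, Or.inr rfl⟩
      refine ⟨w.concat hadj, ?_⟩
      rw [Walk.edges_concat, List.concat_eq_append, List.mem_append, List.mem_singleton]
      rintro (h' | h')
      · exact hw h'
      · rcases Sym2.eq_iff.1 h' with ⟨-, h2⟩ | ⟨-, h2⟩
        · exact hu ⟨0, h2.symm⟩
        · exact hpu ⟨0, h2.symm⟩
  · intro hu w _
    have h0 : n0 ∉ {u | ¬ ∃ k, p^[k] u = m} → False := by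
      intro hn
      obtain ⟨k, hk⟩ := not_not.1 hn
      exact hm (hk.symm.trans (h.iterate_root k))
    obtain ⟨d, hd, h1, h2⟩ := w.exists_boundary_dart {u | ¬ ∃ k, p^[k] u = m}
      (not_not.1 h0) (not_not.2 hu)
    obtain ⟨k, hk⟩ := not_not.1 h2
    have hedge : d.edge ∈ w.edges := List.mem_map_of_mem hd
    rcases ((h.adj _ _).1 d.adj).2 with h' | h'
    · exact absurd ⟨k + 1, by rw [Function.iterate_succ_apply, ← h']; exact hk⟩ h1
    · cases k with
      | zero =>
        have hsnd : d.snd = m := hk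
        rw [hsnd] at h'
        have : d.edge = s(p m, m) := by
          rw [← h', ← hsnd]; rfl
        rwa [← this]
      | succ k =>
        exact absurd ⟨k, by rw [h']; exact hk⟩ h1

theorem orientedEdge_iff (h : IsParentFun T n0 p) (n m : V) :
    OrientedEdge T n0 n m ↔ m ≠ n0 ∧ n = p m := by
  constructor
  · rintro ⟨hadj, hd⟩
    obtain ⟨hne, h' | h'⟩ := (h.adj _ _).1 hadj
    · exfalso
      have hn : n ≠ n0 := by
        rintro rfl
        exact hne (h'.trans h.root).symm
      rw [Sym2.eq_swap, h', h.downward_iff hn] at hd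
      obtain ⟨k, hk⟩ := hd
      exact hn (h.eq_root_of_iterate_eq (k := k) hk)
    · refine ⟨?_, h'⟩
      rintro rfl
      exact hne (h'.trans h.root)
  · rintro ⟨hm, rfl⟩
    exact ⟨(h.adj _ _).2 ⟨h.parent_ne hm, Or.inr rfl⟩, (h.downward_iff hm m).2 ⟨0, rfl⟩⟩

theorem rotate [DecidableEq V] (h : IsParentFun T n0 p) {m n' : V} (hm : m ≠ n0)
    (hn' : ¬ ∃ k, p^[k] n' = m) :
    IsParentFun (rotate T (p m) m n') n0 (Function.update p m n') := by
  have hne : n' ≠ m := fun e => hn' ⟨0, e⟩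
  have step : ∀ u, (∃ k, (Function.update p m n')^[k] (Function.update p m n' u) = n0) →
      ∃ k, (Function.update p m n')^[k] u = n0 := fun u ⟨k, hk⟩ => ⟨k + 1, hk⟩
  have hout : ∀ k u, p^[k] u = n0 → (¬ ∃ k, p^[k] u = m) →
      ∃ k, (Function.update p m n')^[k] u = n0 := by
    intro k
    induction k with
    | zero => exact fun u hu _ => ⟨0, hu⟩
    | succ k ih =>
      intro u hk hu
      apply step
      rw [Function.update_of_ne fun e : u = m => hu ⟨0, e⟩]
      exact ih _ hk fun ⟨j, hj⟩ => hu ⟨j + 1, hj⟩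
  have hmreach : ∃ k, (Function.update p m n')^[k] m = n0 := by
    apply step
    rw [Function.update_self]
    obtain ⟨k, hk⟩ := h.reach n'
    exact hout k n' hk hn'
  have hin : ∀ k u, p^[k] u = m → ∃ k, (Function.update p m n')^[k] u = n0 := by
    intro k
    induction k with
    | zero => exact fun u hu => (show u = m from hu) ▸ hmreach
    | succ k ih =>
      intro u hk
      by_cases hu : u = m
      · rw [hu]; exact hmreach
      · apply step
        rw [Function.update_of_ne hu]
        exact ih _ hk
  refine ⟨?_, ?_, ?_⟩
  · rw [Function.update_of_ne hm.symm, h.root]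
  · intro u
    by_cases hu : ∃ k, p^[k] u = m
    · obtain ⟨k, hk⟩ := hu
      exact hin k u hk
    · obtain ⟨k, hk⟩ := h.reach u
      exact hout k u hk hu
  · have hpp : p (p m) ≠ m := fun e => hm (h.eq_root_of_iterate_eq (k := 1) e)
    have hpm := h.parent_ne hm
    intro a b
    simp only [_root_.rotate, sup_adj, deleteEdges_adj, fromEdgeSet_adj, Set.mem_singleton_iff,
      Sym2.eq_iff, h.adj, Function.update_apply]
    grind

theorem eq_graph (h : IsParentFun T n0 p) {T' : SimpleGraph V} (h' : IsParentFun T' n0 p) :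
    T = T' := by
  ext a b
  rw [h.adj, h'.adj]

theorem mismatches_eq [Fintype V] (h : IsParentFun T n0 p) {T' : SimpleGraph V} {q : V → V}
    (h' : IsParentFun T' n0 q) : mismatches T T' n0 = {m | p m ≠ q m}.ncard := by
  rw [mismatches, ← Set.ncard_image_of_injective {m | p m ≠ q m}
    (f := fun m => (p m, m)) fun a b hab => congrArg Prod.snd hab]
  congr 1
  ext ⟨n, m⟩
  have := h.root
  have := h'.root
  simp only [h.orientedEdge_iff, h'.orientedEdge_iff, Set.mem_ofPred_eq, Set.mem_image,
    Prod.mk.injEq]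
  grind

theorem exists_mismatch_not_descendant (h : IsParentFun T n0 p) {T' : SimpleGraph V} {q : V → V}
    (h' : IsParentFun T' n0 q) (hpq : p ≠ q) :
    ∃ m, p m ≠ q m ∧ ¬ ∃ k, p^[k] (q m) = m := by
  classical
  have hex : ∃ k m, q^[k] m = n0 ∧ p m ≠ q m := by
    obtain ⟨m, hm⟩ := Function.ne_iff.1 hpq
    obtain ⟨k, hk⟩ := h'.reach m
    exact ⟨k, m, hk, hm⟩
  obtain ⟨m, hk, hm⟩ := Nat.find_spec hex
  have hmroot : m ≠ n0 := by
    rintro rfl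
    exact hm (h.root.trans h'.root.symm)
  have hmin : ∀ j, p (q^[j + 1] m) = q (q^[j + 1] m) := by
    intro j
    by_contra hj
    by_cases hlt : j + 1 ≤ Nat.find hex
    · refine Nat.find_min hex (m := Nat.find hex - (j + 1)) (by omega) ⟨_, ?_, hj⟩
      rw [← Function.iterate_add_apply, Nat.sub_add_cancel hlt, hk]
    · have : q^[j + 1] m = n0 := by
        rw [show j + 1 = (j + 1 - Nat.find hex) + Nat.find hex by omega,
          Function.iterate_add_apply, hk, h'.iterate_root]
      rw [this, h.root, h'.root] at hj
      exact hj rfl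
  have hiter : ∀ j, p^[j] (q m) = q^[j + 1] m := by
    intro j
    induction j with
    | zero => rfl
    | succ j ih =>
      rw [Function.iterate_succ_apply', ih, hmin, ← Function.iterate_succ_apply' q]
  refine ⟨m, hm, fun ⟨j, hj⟩ => hmroot ?_⟩
  rw [hiter] at hj
  exact h'.eq_root_of_iterate_eq hj

theorem exists_rotation_sequence [Finite V] {G T' : SimpleGraph V} {q : V → V}
    (h : IsParentFun T n0 p) (h' : IsParentFun T' n0 q) (hG : T' ≤ G) :
    ∃ c : ℕ → SimpleGraph V, c 0 = T ∧ c {m | p m ≠ q m}.ncard = T' ∧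
      ∀ i < {m | p m ≠ q m}.ncard, ValidRotation G n0 (c i) (c (i + 1)) := by
  classical
  induction hN : {m | p m ≠ q m}.ncard generalizing T p with
  | zero =>
    have hpq : p = q := by
      rw [Set.ncard_eq_zero, Set.eq_empty_iff_forall_notMem] at hN
      funext m
      exact not_not.1 (hN m)
    subst hpq
    exact ⟨fun _ => T, rfl, h.eq_graph h', by simp⟩
  | succ N ih =>
    have hpq : p ≠ q := by
      rintro rfl
      simp at hN
    obtain ⟨m, hm, hdesc⟩ := h.exists_mismatch_not_descendant h' hpq
    have hmroot : m ≠ n0 := by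
      rintro rfl
      exact hm (h.root.trans h'.root.symm)
    have hset : {x | Function.update p m (q m) x ≠ q x} = {x | p x ≠ q x} \ {m} := by
      ext x
      simp only [Set.mem_ofPred_eq, Set.mem_sdiff, Set.mem_singleton_iff, Function.update_apply]
      grind
    obtain ⟨c, hc0, hcN, hc⟩ := ih (h.rotate hmroot hdesc) (by
      rw [hset, Set.ncard_sdiff_singleton_of_mem hm, hN, Nat.add_sub_cancel])
    have hrot : ValidRotation G n0 T (_root_.rotate T (p m) m (q m)) := by
      refine ⟨p m, m, q m, (h.orientedEdge_iff _ _).2 ⟨hmroot, rfl⟩,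
        hG ((h'.adj _ _).2 ⟨h'.parent_ne hmroot, Or.inr rfl⟩), ?_, ?_, rfl⟩
      · rw [h.adj]
        rintro ⟨-, h1 | h1⟩
        · exact hdesc ⟨1, h1.symm⟩
        · exact hm h1.symm
      · rwa [h.downward_iff hmroot]
    refine ⟨fun i => Nat.casesOn i T c, rfl, hcN, ?_⟩
    rintro (_ | i) hi
    · change ValidRotation G n0 T (c 0)
      rwa [hc0]
    · exact hc i (by omega)

end IsParentFun

/-- Two spanning trees `T, T'` of a connected graph `G` rooted at
`n0` can be reconfigured into each other by a sequence of exactly `N(T,T')` valid edge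
rotations. -/
theorem stmt4 {V : Type*} [Fintype V] (G : SimpleGraph V) (n0 : V)
    (hconn : G.Connected) (T T' : SimpleGraph V)
    (hT : IsSpanningTreeOf G T) (hT' : IsSpanningTreeOf G T') :
    ∃ c : ℕ → SimpleGraph V, c 0 = T ∧ c (mismatches T T' n0) = T' ∧
      ∀ i < mismatches T T' n0, ValidRotation G n0 (c i) (c (i + 1)) := by
  obtain ⟨p, hp⟩ := hT.exists_isParentFun n0
  obtain ⟨q, hq⟩ := hT'.exists_isParentFun n0
  rw [hp.mismatches_eq hq]
  exact hp.exists_rotation_sequence hq hT'.1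
end

section
/- Let S be a nonempty finite set of positive integers with total sum Q. Construct the graph G with node set {x, a, b} together with one node v_s for each s in S, and edge set consisting of {x,a}, {x,b}, and, for each s in S, the edges {a, v_s} and {b, v_s}. Assign demands f_a = 0, f_b = 0, f_{v_s} = s for each s in S, and f_x = -Q, and dissipation constants alpha = 1 on the edges {x,a} and {x,b} and alpha = 0 on all other edges. Then S admits a partition into two disjoint subsets A and B with A union B = S and equal sums (sum of A = sum of B = Q/2) if and only if G has a spanning tree T with dissipation cost C(T) <= floor(Q^2 / 2). -/
open SimpleGraph
open scoped Classical

/-- The flow on the oriented tree edge `(a, b)` determined by Kirchhoff's current law: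
the sum of the demands over all nodes downward of the edge. -/
noncomputable def edgeFlow {V : Type*} [Fintype V] (T : SimpleGraph V) (n0 : V)
    (f : V → ℝ) (a b : V) : ℝ :=
  ∑ u : V, if Downward T n0 s(a, b) u then f u else 0

/-- The dissipation cost `C(T) = ∑_{e ∈ T} α_e f_e(T)^2` of the spanning tree `T`
(each tree edge taken with its unique orientation away from the root `n0`, which does
not affect the squared flows). -/
noncomputable def treeCost {V : Type*} [Fintype V] (T : SimpleGraph V) (n0 : V)
    (f : V → ℝ) (α : Sym2 V → ℝ) : ℝ :=
  ∑ p : V × V,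
    if OrientedEdge T n0 p.1 p.2 then α s(p.1, p.2) * (edgeFlow T n0 f p.1 p.2) ^ 2
    else 0

/-- The node set of the Partition-to-MDST construction: the three nodes `x, a, b`
(encoded as `Fin 3`) together with one node `v_s` for each `s ∈ S`. -/
abbrev PNode (S : Finset ℕ) := Fin 3 ⊕ {s : ℕ // s ∈ S}

def xNode (S : Finset ℕ) : PNode S := Sum.inl 0
def aNode (S : Finset ℕ) : PNode S := Sum.inl 1
def bNode (S : Finset ℕ) : PNode S := Sum.inl 2

/-- The graph of the constructed MDST instance: edges `{x,a}`, `{x,b}`, and `{a,v_s}`,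
`{b,v_s}` for each `s ∈ S`. -/
def pGraph (S : Finset ℕ) : SimpleGraph (PNode S) :=
  SimpleGraph.fromEdgeSet
    ({s(xNode S, aNode S), s(xNode S, bNode S)} ∪
      {e | ∃ v : {s : ℕ // s ∈ S},
        e = s(aNode S, Sum.inr v) ∨ e = s(bNode S, Sum.inr v)})

/-- The demands: `f_a = f_b = 0`, `f_{v_s} = s`, and `f_x = -Q` where `Q = ∑_{s ∈ S} s`. -/
noncomputable def pDemand (S : Finset ℕ) : PNode S → ℝ
  | Sum.inl i => if i = 0 then -((∑ s ∈ S, s : ℕ) : ℝ) else 0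
  | Sum.inr v => ((v : ℕ) : ℝ)

/-- The dissipation constants: `1` on `{x,a}` and `{x,b}`, and `0` on all other edges. -/
noncomputable def pAlpha (S : Finset ℕ) (e : Sym2 (PNode S)) : ℝ :=
  if e = s(xNode S, aNode S) ∨ e = s(xNode S, bNode S) then 1 else 0

namespace Downward

variable {V : Type*} {T : SimpleGraph V} {n0 u : V} {e : Sym2 V}

theorem iff_mem_edges (hT : T.IsAcyclic) (p : T.Walk n0 u) (hp : p.IsPath) :
    Downward T n0 e u ↔ e ∈ p.edges := by
  refine ⟨fun h => h p hp, fun h q hq => ?_⟩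
  have hqp : q = p := congrArg Subtype.val
    ((hT.subsingleton_path n0 u).elim ⟨q, hq⟩ ⟨p, hp⟩)
  rwa [hqp]

theorem not_root : ¬ Downward T n0 e n0 := fun h => by
  simpa using h Walk.nil Walk.IsPath.nil

theorem mem_edgeSet (hT : T.Connected) (h : Downward T n0 e u) : e ∈ T.edgeSet := by
  obtain ⟨p, hp⟩ := hT.exists_isPath n0 u
  exact p.edges_subset_edgeSet (h p hp)

end Downward

theorem orientedEdge_of_adj_root {V : Type*} {T : SimpleGraph V} {n0 m : V}
    (hT : T.IsAcyclic) (h : T.Adj n0 m) : OrientedEdge T n0 n0 m :=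
  ⟨h, (Downward.iff_mem_edges hT (Walk.cons h Walk.nil) (by simp [h.ne])).2 (by simp)⟩

/-- A finite graph in which every edge joins a non-root node to its parent and every node reaches
the root is a tree. -/
theorem isTree_of_parent {V : Type*} [Fintype V] (r : V) (par : V → V) (T : SimpleGraph V)
    (hT : T.edgeSet ⊆ (fun v => s(v, par v)) '' {r}ᶜ) (hr : ∀ v, T.Reachable v r) :
    T.IsTree := by
  have : Nonempty V := ⟨r⟩
  have hc : T.Connected := ⟨fun u v => (hr u).trans (hr v).symm⟩
  refine isTree_iff_connected_and_card.2 ⟨hc, le_antisymm ?_ hc.card_vert_le_card_edgeSet_add_one⟩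
  have h₁ : Nat.card T.edgeSet ≤ ({r}ᶜ : Set V).ncard :=
    (Set.ncard_le_ncard hT (Set.toFinite _)).trans (Set.ncard_image_le (Set.toFinite _))
  have h₂ := Set.ncard_add_ncard_compl ({r} : Set V)
  rw [Set.ncard_singleton] at h₂
  omega

section PartitionGraph

variable {S : Finset ℕ} {T : SimpleGraph (PNode S)}

theorem pGraph_adj_xNode {w : PNode S} (h : (pGraph S).Adj (xNode S) w) :
    w = aNode S ∨ w = bNode S := by
  simp only [pGraph, fromEdgeSet_adj] at h
  obtain ⟨(h | h) | ⟨v, h | h⟩, -⟩ := h <;>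
    simp_all [xNode, aNode, bNode]

theorem downward_bNode_iff (hT : T.IsTree) (hG : T ≤ pGraph S) {u : PNode S}
    (hu : u ≠ xNode S) :
    Downward T (xNode S) s(xNode S, bNode S) u ↔
      ¬ Downward T (xNode S) s(xNode S, aNode S) u := by
  obtain ⟨p, hp⟩ := hT.connected.exists_isPath (xNode S) u
  rw [Downward.iff_mem_edges hT.isAcyclic p hp, Downward.iff_mem_edges hT.isAcyclic p hp]
  cases p with
  | nil => exact absurd rfl hu
  | cons h q =>
    have hx : ∀ y, s(xNode S, y) ∉ q.edges := fun y hy =>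
      ((Walk.cons_isPath_iff _ _).1 hp).2 (q.fst_mem_support_of_mem_edges hy)
    obtain rfl | rfl := pGraph_adj_xNode (hG h) <;>
      simp [hx] <;> simp [xNode, aNode, bNode]

/-- The flow on an edge at the root `x` is the total demand of the nodes `v_s` downward of it. -/
theorem edgeFlow_pDemand (y : PNode S) :
    edgeFlow T (xNode S) (pDemand S) (xNode S) y =
      ∑ v : {s : ℕ // s ∈ S},
        if Downward T (xNode S) s(xNode S, y) (Sum.inr v) then ((v : ℕ) : ℝ) else 0 := by
  have h0 : ¬ Downward T (xNode S) s(xNode S, y) (Sum.inl 0) := Downward.not_root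
  simp [edgeFlow, Fintype.sum_sum_type, Fin.sum_univ_three, pDemand, h0]

theorem edgeFlow_eq_zero (hT : T.IsTree) {f : PNode S → ℝ} {y : PNode S}
    (h : ¬ OrientedEdge T (xNode S) (xNode S) y) :
    edgeFlow T (xNode S) f (xNode S) y = 0 := by
  refine Finset.sum_eq_zero fun u _ => if_neg fun hu => h ?_
  exact orientedEdge_of_adj_root hT.isAcyclic (hu.mem_edgeSet hT.connected)

theorem treeCost_pAlpha (hT : T.IsTree) (f : PNode S → ℝ) :
    treeCost T (xNode S) f (pAlpha S) =
      edgeFlow T (xNode S) f (xNode S) (aNode S) ^ 2 +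
        edgeFlow T (xNode S) f (xNode S) (bNode S) ^ 2 := by
  have key : ∀ p : PNode S × PNode S,
      (if OrientedEdge T (xNode S) p.1 p.2 then
        pAlpha S s(p.1, p.2) * (edgeFlow T (xNode S) f p.1 p.2) ^ 2 else 0) =
      (if p = (xNode S, aNode S) then
        edgeFlow T (xNode S) f (xNode S) (aNode S) ^ 2 else 0) +
      (if p = (xNode S, bNode S) then
        edgeFlow T (xNode S) f (xNode S) (bNode S) ^ 2 else 0) := by
    rintro ⟨n, m⟩
    have hab : aNode S ≠ bNode S := by simp [aNode, bNode]
    by_cases ha : (n, m) = (xNode S, aNode S)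
    · obtain ⟨rfl, rfl⟩ := Prod.mk.inj ha
      by_cases ho : OrientedEdge T (xNode S) (xNode S) (aNode S)
      · simp [ho, pAlpha, hab]
      · simp [ho, edgeFlow_eq_zero hT ho, hab]
    by_cases hb : (n, m) = (xNode S, bNode S)
    · obtain ⟨rfl, rfl⟩ := Prod.mk.inj hb
      by_cases ho : OrientedEdge T (xNode S) (xNode S) (bNode S)
      · simp [ho, pAlpha, hab.symm]
      · simp [ho, edgeFlow_eq_zero hT ho, hab.symm]
    rw [if_neg ha, if_neg hb, add_zero]
    refine ite_eq_right_iff.2 fun ho => ?_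
    have hm : m ≠ xNode S := by
      rintro rfl
      exact Downward.not_root ho.2
    have hα : pAlpha S s(n, m) = 0 := by
      refine if_neg ?_
      rw [Sym2.eq_iff, Sym2.eq_iff]
      rw [Prod.mk.injEq] at ha hb
      tauto
    rw [hα, zero_mul]
  rw [treeCost, Finset.sum_congr rfl fun p _ => key p, Finset.sum_add_distrib]
  simp

/-- The elements of `S` whose nodes are served through `a`. -/
noncomputable def servedByA (T : SimpleGraph (PNode S)) : Finset ℕ :=
  S.filter fun s => ∃ h : s ∈ S,
    Downward T (xNode S) s(xNode S, aNode S) (Sum.inr ⟨s, h⟩)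

theorem treeCost_eq (hT : T.IsTree) (hG : T ≤ pGraph S) :
    treeCost T (xNode S) (pDemand S) (pAlpha S) =
      (((∑ s ∈ servedByA T, s) ^ 2 + (∑ s ∈ S \ servedByA T, s) ^ 2 : ℕ) : ℝ) := by
  rw [treeCost_pAlpha hT, edgeFlow_pDemand, edgeFlow_pDemand]
  have hmem : ∀ v : {s : ℕ // s ∈ S}, (v : ℕ) ∈ servedByA T ↔
      Downward T (xNode S) s(xNode S, aNode S) (Sum.inr v) := fun v => by
    simp [servedByA]
  have hb : ∀ v : {s : ℕ // s ∈ S}, Downward T (xNode S) s(xNode S, bNode S) (Sum.inr v) ↔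
      (v : ℕ) ∉ servedByA T := fun v => by
    rw [hmem, downward_bNode_iff hT hG (by simp [xNode])]
  have hsub : servedByA T ⊆ S := Finset.filter_subset _ _
  simp only [← hmem, hb]
  push_cast
  congr 2
  · rw [Finset.sum_coe_sort S fun s => if s ∈ servedByA T then (s : ℝ) else 0,
      Finset.sum_ite_mem, Finset.inter_eq_right.2 hsub]
  · rw [Finset.sum_coe_sort S fun s => if s ∉ servedByA T then (s : ℝ) else 0,
      ← Finset.sum_filter, ← Finset.sdiff_eq_filter]

/-- The parent function of the tree serving the elements of `A` through `a` and the rest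
through `b`. -/
noncomputable def partitionParent (S A : Finset ℕ) : PNode S → PNode S
  | Sum.inl _ => xNode S
  | Sum.inr v => if (v : ℕ) ∈ A then aNode S else bNode S

/-- The spanning tree serving the elements of `A` through `a` and the rest through `b`. -/
noncomputable def partitionTree (S A : Finset ℕ) : SimpleGraph (PNode S) :=
  fromEdgeSet ((fun v => s(v, partitionParent S A v)) '' {xNode S}ᶜ)

theorem partitionTree_adj (A : Finset ℕ) {v : PNode S} (hv : v ≠ xNode S) :
    (partitionTree S A).Adj (partitionParent S A v) v := by
  rw [partitionTree, fromEdgeSet_adj]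
  refine ⟨⟨v, hv, Sym2.eq_swap⟩, ?_⟩
  rcases v with i | v
  · exact hv.symm
  · simp only [partitionParent]
    split_ifs <;> simp [aNode, bNode]

theorem partitionTree_le (A : Finset ℕ) : partitionTree S A ≤ pGraph S := by
  refine fromEdgeSet_mono ?_
  rintro _ ⟨i | v, hv, rfl⟩
  · left
    fin_cases i
    · exact absurd rfl hv
    · left; exact Sym2.eq_swap
    · right; exact Sym2.eq_swap
  · right
    refine ⟨v, ?_⟩
    simp only [partitionParent]
    split_ifs
    · left; exact Sym2.eq_swap
    · right; exact Sym2.eq_swap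

theorem partitionTree_isTree (A : Finset ℕ) : (partitionTree S A).IsTree := by
  have hadj := fun v => partitionTree_adj (S := S) A (v := v)
  have hinl : ∀ i : Fin 3, (partitionTree S A).Reachable (Sum.inl i) (xNode S) := fun i => by
    by_cases hi : (Sum.inl i : PNode S) = xNode S
    · rw [hi]
    · exact (hadj _ hi).symm.reachable
  refine isTree_of_parent (xNode S) (partitionParent S A) _ ?_ ?_
  · rw [partitionTree, edgeSet_fromEdgeSet]
    exact Set.sdiff_subset
  · rintro (i | v)
    · exact hinl i
    · refine (hadj (Sum.inr v) (by simp [xNode])).symm.reachable.trans ?_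
      simp only [partitionParent]
      split_ifs
      · exact hinl 1
      · exact hinl 2

theorem downward_partitionTree (A : Finset ℕ) (v : {s : ℕ // s ∈ S}) :
    Downward (partitionTree S A) (xNode S) s(xNode S, aNode S) (Sum.inr v) ↔ (v : ℕ) ∈ A := by
  have hxv : xNode S ≠ Sum.inr v := by simp [xNode]
  have hv := partitionTree_adj (S := S) A hxv.symm
  by_cases hA : (v : ℕ) ∈ A
  · simp only [partitionParent, if_pos hA] at hv
    have ha : (partitionTree S A).Adj (xNode S) (aNode S) :=
      partitionTree_adj A (v := aNode S) (by simp [xNode, aNode])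
    have hp : (Walk.cons ha (Walk.cons hv Walk.nil)).IsPath := by
      simp [hv.ne, ha.ne, hxv]
    rw [Downward.iff_mem_edges (partitionTree_isTree A).isAcyclic _ hp]
    simp [hA]
  · simp only [partitionParent, if_neg hA] at hv
    have hb : (partitionTree S A).Adj (xNode S) (bNode S) :=
      partitionTree_adj A (v := bNode S) (by simp [xNode, bNode])
    have hp : (Walk.cons hb (Walk.cons hv Walk.nil)).IsPath := by
      simp [hv.ne, hb.ne, hxv]
    rw [Downward.iff_mem_edges (partitionTree_isTree A).isAcyclic _ hp]
    have hab : aNode S ≠ bNode S := by simp [aNode, bNode]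
    simp [hA, hb.ne, hxv, hab]

theorem servedByA_partitionTree {A : Finset ℕ} (hA : A ⊆ S) :
    servedByA (partitionTree S A) = A := by
  ext s
  simp only [servedByA, downward_partitionTree, Finset.mem_filter, exists_prop]
  exact ⟨fun h => h.2.2, fun h => ⟨hA h, hA h, h⟩⟩

end PartitionGraph

/-- For a nonempty finite set `S` of positive integers with total
sum `Q`, the set `S` admits a partition into two disjoint subsets with equal sums if
and only if the constructed graph has a spanning tree `T` with dissipation cost
`C(T) ≤ ⌊Q² / 2⌋`. -/
theorem stmt10 (S : Finset ℕ) (hS : S.Nonempty) (hpos : ∀ s ∈ S, 0 < s) :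
    (∃ A B : Finset ℕ, A ∪ B = S ∧ Disjoint A B ∧ ∑ s ∈ A, s = ∑ s ∈ B, s) ↔
    (∃ T : SimpleGraph (PNode S), IsSpanningTreeOf (pGraph S) T ∧
      treeCost T (xNode S) (pDemand S) (pAlpha S) ≤ (((∑ s ∈ S, s) ^ 2 / 2 : ℕ) : ℝ)) := by
  constructor
  · rintro ⟨A, B, rfl, hAB, hsum⟩
    refine ⟨partitionTree (A ∪ B) A, ⟨partitionTree_le A, partitionTree_isTree A⟩, ?_⟩
    rw [treeCost_eq (partitionTree_isTree A) (partitionTree_le A),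
      servedByA_partitionTree Finset.subset_union_left, Finset.union_sdiff_cancel_left hAB,
      Finset.sum_union hAB, ← hsum, Nat.cast_le, Nat.le_div_iff_mul_le two_pos]
    exact le_of_eq (by ring)
  · rintro ⟨T, ⟨hG, hT⟩, hcost⟩
    have hsub : servedByA T ⊆ S := Finset.filter_subset _ _
    refine ⟨servedByA T, S \ servedByA T, Finset.union_sdiff_of_subset hsub,
      Finset.disjoint_sdiff, ?_⟩
    rw [treeCost_eq hT hG, Nat.cast_le, Nat.le_div_iff_mul_le two_pos,
      ← Finset.sum_sdiff hsub] at hcost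
    zify at hcost ⊢
    nlinarith [sq_nonneg ((∑ s ∈ servedByA T, s : ℤ) - ∑ s ∈ S \ servedByA T, s)]
end

section
/- Let I be a Set Cover instance with universe U = {u_1, ..., u_nu} (nu >= 1) and collection of subsets S = {S_1, ..., S_mu} whose union is U, and let I' be the MDST instance produced from I by the forward mapping. Let T be any spanning tree of the graph G of I' (a solution to I'). Let ell in {1, ..., mu} be an index minimizing the number of nodes in V_{S,ell} = {s_{1,ell}, ..., s_{mu,ell}} that have degree at least 2 in T, and define x = { S_i : s_{i,ell} has degree at least 2 in T }. Then x is a set cover of U, i.e., the union of the subsets in x equals U. -/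
open SimpleGraph
open scoped Classical

/-- The node set of the forward mapping: the two source nodes `y, z` (encoded as
`Fin 2`), the nodes `s_{i,ℓ}` for `i, ℓ ∈ {1,…,μ}`, and the nodes `u_{j,ℓ}` for
`j ∈ {1,…,ν}`, `ℓ ∈ {1,…,μ}`. -/
abbrev SCNode (ν μ : ℕ) := Fin 2 ⊕ ((Fin μ × Fin μ) ⊕ (Fin ν × Fin μ))

def yNode (ν μ : ℕ) : SCNode ν μ := Sum.inl 0
def zNode (ν μ : ℕ) : SCNode ν μ := Sum.inl 1
def sNode (ν μ : ℕ) (i l : Fin μ) : SCNode ν μ := Sum.inr (Sum.inl (i, l))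
def uNode (ν μ : ℕ) (j : Fin ν) (l : Fin μ) : SCNode ν μ := Sum.inr (Sum.inr (j, l))

/-- The edges of the forward mapping: `{y,z}`; `{y, s_{i,ℓ}}` and `{z, s_{i,ℓ}}` for
all `i, ℓ`; and `{s_{i,ℓ}, u_{j,ℓ}}` whenever `u_j ∈ S_i`. -/
def scEdges (ν μ : ℕ) (Sets : Fin μ → Finset (Fin ν)) : Set (Sym2 (SCNode ν μ)) :=
  {s(yNode ν μ, zNode ν μ)} ∪
  {e | ∃ i l, e = s(yNode ν μ, sNode ν μ i l) ∨ e = s(zNode ν μ, sNode ν μ i l)} ∪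
  {e | ∃ i l j, j ∈ Sets i ∧ e = s(sNode ν μ i l, uNode ν μ j l)}

/-- The graph `G` of the MDST instance produced by the forward mapping. -/
def scGraph (ν μ : ℕ) (Sets : Fin μ → Finset (Fin ν)) : SimpleGraph (SCNode ν μ) :=
  SimpleGraph.fromEdgeSet (scEdges ν μ Sets)

/-- The demands of the forward mapping: `f_y = -μ²`, `f_z = -ν μ³`, `f_v = 1` for
`v ∈ V_S`, and `f_v = μ²` for `v ∈ V_U`. -/
noncomputable def scDemand (ν μ : ℕ) : SCNode ν μ → ℝ
  | Sum.inl i => if i = 0 then -((μ : ℝ) ^ 2) else -((ν : ℝ) * (μ : ℝ) ^ 3)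
  | Sum.inr (Sum.inl _) => 1
  | Sum.inr (Sum.inr _) => (μ : ℝ) ^ 2

/-- The dissipation constants of the forward mapping: `α_e = 1` for edges incident to
`y`, and `α_e = 0` otherwise. -/
noncomputable def scAlpha (ν μ : ℕ) (e : Sym2 (SCNode ν μ)) : ℝ :=
  if yNode ν μ ∈ e then 1 else 0

/-- The cost of a solution (spanning tree) `T` of the MDST instance produced by the
forward mapping. -/
noncomputable def scCost (ν μ : ℕ) (T : SimpleGraph (SCNode ν μ)) : ℝ :=
  treeCost T (yNode ν μ) (scDemand ν μ) (scAlpha ν μ)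

/-- The node `v` has degree at least `2` in the graph `T`. -/
def DegTwo {W : Type*} (T : SimpleGraph W) (v : W) : Prop :=
  2 ≤ {w | T.Adj v w}.ncard

/-- The neighbours of `u_{j,ℓ}` are the nodes `s_{i,ℓ}` with `u_j ∈ S_i`. -/
theorem scGraph_adj_uNode {ν μ : ℕ} {Sets : Fin μ → Finset (Fin ν)} {j : Fin ν} {l : Fin μ}
    {w : SCNode ν μ} (h : (scGraph ν μ Sets).Adj (uNode ν μ j l) w) :
    ∃ i, j ∈ Sets i ∧ w = sNode ν μ i l := by
  obtain ⟨h, -⟩ := (SimpleGraph.fromEdgeSet_adj _).1 h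
  rcases h with (h | ⟨i, l', h | h⟩) | ⟨i, l', j', hj, h⟩
  · simp [uNode, yNode, zNode] at h
  · simp [uNode, yNode, sNode] at h
  · simp [uNode, zNode, sNode] at h
  · rcases Sym2.eq_iff.1 h with ⟨hu, -⟩ | ⟨hu, hw⟩
    · simp [uNode, sNode] at hu
    · simp only [uNode, Sum.inr.injEq, Prod.mk.injEq] at hu
      obtain ⟨rfl, rfl⟩ := hu
      exact ⟨i, hj, hw⟩

/-- A node with two distinct neighbours in a finite graph has degree at least `2`. -/
theorem degTwo_of_adj_of_adj {W : Type*} [Finite W] {T : SimpleGraph W} {v a b : W}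
    (ha : T.Adj v a) (hb : T.Adj v b) (hab : a ≠ b) : DegTwo T v :=
  (Set.one_lt_ncard (Set.toFinite _)).2 ⟨a, ha, b, hb, hab⟩

/-- Let `T` be any spanning tree of the graph of the MDST instance
produced by the forward mapping from a Set Cover instance, let `ℓ` be an index
minimizing the number of nodes of `V_{S,ℓ}` of degree at least `2` in `T`, and let
`x = { S_i : s_{i,ℓ} has degree ≥ 2 in T }`.  Then `x` is a set cover of the
universe. -/
theorem stmt11 (ν μ : ℕ) (hν : 1 ≤ ν) (Sets : Fin μ → Finset (Fin ν))
    (hcover : ∀ j : Fin ν, ∃ i : Fin μ, j ∈ Sets i)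
    (T : SimpleGraph (SCNode ν μ)) (hT : IsSpanningTreeOf (scGraph ν μ Sets) T)
    (l : Fin μ)
    (hl : ∀ l' : Fin μ,
      {i : Fin μ | DegTwo T (sNode ν μ i l)}.ncard ≤
        {i : Fin μ | DegTwo T (sNode ν μ i l')}.ncard) :
    ∀ j : Fin ν, ∃ i : Fin μ, DegTwo T (sNode ν μ i l) ∧ j ∈ Sets i := by
  intro j
  obtain ⟨p, hp⟩ := (hT.2.connected (uNode ν μ j l) (yNode ν μ)).exists_isPath
  cases p with
  | cons h q =>
    obtain ⟨i, hj, rfl⟩ := scGraph_adj_uNode (hT.1 h)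
    cases q with
    | cons h' r =>
      refine ⟨i, degTwo_of_adj_of_adj h.symm h' ?_, hj⟩
      rintro rfl
      simp at hp
end

section
/- Let I be a Set Cover instance with universe U = {u_1, ..., u_nu} (nu >= 1) and collection of subsets S = {S_1, ..., S_mu} whose union is U, and let I' be the MDST instance produced from I by the forward mapping. Then for every spanning tree T of the graph G of I', the dissipation cost satisfies C(T) >= d^2, where d is the number of nodes of V_S that have degree at least 2 in T. -/
open SimpleGraph
open scoped Classical

section TreeBranches

variable {V : Type*} {T : SimpleGraph V}

theorem downward_iff_mem_edges (hT : T.IsTree) {r v : V} {e : Sym2 V} {p : T.Walk r v}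
    (hp : p.IsPath) : Downward T r e v ↔ e ∈ p.edges := by
  refine ⟨fun h => h p hp, fun h q hq => ?_⟩
  have : (⟨q, hq⟩ : T.Path r v) = ⟨p, hp⟩ := (hT.isAcyclic.subsingleton_path r v).elim _ _
  rw [show q = p from congrArg Subtype.val this]
  exact h

theorem not_downward_root {r : V} {e : Sym2 V} : ¬ Downward T r e r := fun h => by
  simpa using h Walk.nil Walk.IsPath.nil

theorem orientedEdge_root (hT : T.IsTree) {r c : V} (h : T.Adj r c) : OrientedEdge T r r c := by
  refine ⟨h, (downward_iff_mem_edges hT (p := Walk.cons h Walk.nil) ?_).2 ?_⟩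
  · simp [h.ne]
  · simp

theorem exists_adj_root_downward (hT : T.IsTree) {r v : V} (hv : v ≠ r) :
    ∃ c, T.Adj r c ∧ Downward T r s(r, c) v := by
  obtain ⟨p, hp⟩ := (hT.connected.preconnected r v).exists_isPath
  cases p with
  | nil => exact absurd rfl hv
  | cons h q => exact ⟨_, h, (downward_iff_mem_edges hT hp).2 (by simp)⟩

theorem root_branch_unique (hT : T.IsTree) {r v c c' : V} (hc : Downward T r s(r, c) v)
    (hc' : Downward T r s(r, c') v) : c = c' := by
  obtain ⟨p, hp⟩ := (hT.connected.preconnected r v).exists_isPath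
  have h1 := hc p hp
  have h2 := hc' p hp
  cases p with
  | nil => simp at h1
  | @cons _ x _ h q =>
    have key : ∀ d, s(r, d) ∈ (Walk.cons h q).edges → d = x := by
      intro d hd
      rw [Walk.edges_cons, List.mem_cons] at hd
      rcases hd with hd | hd
      · rcases Sym2.eq_iff.1 hd with ⟨-, hd⟩ | ⟨h', -⟩
        · exact hd
        · exact absurd h' h.ne
      · exact absurd (q.fst_mem_support_of_mem_edges hd) ((Walk.cons_isPath_iff _ _).1 hp).2
    rw [key c h1, key c' h2]

theorem Downward.of_adj (hT : T.IsTree) {r v w c : V} (hw : Downward T r s(r, c) w)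
    (h : T.Adj w v) (hv : v ≠ r) : Downward T r s(r, c) v := by
  obtain ⟨p, hp⟩ := (hT.connected.preconnected r w).exists_isPath
  by_cases hs : v ∈ p.support
  · obtain ⟨c', -, hc'⟩ := exists_adj_root_downward hT hv
    have hmem := p.edges_takeUntil_subset_edges hs (hc' _ (hp.takeUntil hs))
    rwa [root_branch_unique hT hw ((downward_iff_mem_edges hT hp).2 hmem)]
  · refine (downward_iff_mem_edges hT (hp.concat hs h)).2 ?_
    rw [Walk.edges_concat]
    simpa using Or.inl (hw p hp)

theorem sq_edgeFlow_le_treeCost [Fintype V] (hT : T.IsTree) {r c : V} (f : V → ℝ)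
    {α : Sym2 V → ℝ} (hα : ∀ e, 0 ≤ α e) (h : T.Adj r c) :
    α s(r, c) * edgeFlow T r f r c ^ 2 ≤ treeCost T r f α := by
  have key := Finset.single_le_sum
    (f := fun p : V × V => if OrientedEdge T r p.1 p.2 then
      α s(p.1, p.2) * (edgeFlow T r f p.1 p.2) ^ 2 else 0)
    (fun p _ => by
      split_ifs
      · exact mul_nonneg (hα _) (sq_nonneg _)
      · exact le_rfl) (Finset.mem_univ (r, c))
  simpa [treeCost, orientedEdge_root hT h] using key

end TreeBranches

theorem sq_edgeFlow_le_scCost {ν μ : ℕ} {T : SimpleGraph (SCNode ν μ)} (hT : T.IsTree)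
    {c : SCNode ν μ} (h : T.Adj (yNode ν μ) c) :
    edgeFlow T (yNode ν μ) (scDemand ν μ) (yNode ν μ) c ^ 2 ≤ scCost ν μ T := by
  have := sq_edgeFlow_le_treeCost hT (scDemand ν μ) (α := scAlpha ν μ)
    (fun e => by unfold scAlpha; split_ifs <;> norm_num) h
  simpa [scCost, scAlpha] using this

theorem scGraph_sNode_adj {ν μ : ℕ} {Sets : Fin μ → Finset (Fin ν)} {i l : Fin μ}
    {w : SCNode ν μ} (h : (scGraph ν μ Sets).Adj (sNode ν μ i l) w) :
    w = yNode ν μ ∨ w = zNode ν μ ∨ ∃ j l', w = uNode ν μ j l' := by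
  rcases w with a | a | a
  · fin_cases a
    · exact Or.inl rfl
    · exact Or.inr (Or.inl rfl)
  · simp [scGraph, scEdges, sNode, yNode, zNode, uNode] at h
  · exact Or.inr (Or.inr ⟨a.1, a.2, rfl⟩)

theorem edgeFlow_root_branch {ν μ : ℕ} (T : SimpleGraph (SCNode ν μ)) (c : SCNode ν μ) :
    edgeFlow T (yNode ν μ) (scDemand ν μ) (yNode ν μ) c =
      (if Downward T (yNode ν μ) s(yNode ν μ, c) (zNode ν μ) then -((ν : ℝ) * (μ : ℝ) ^ 3) else 0) +
      ((∑ p : Fin μ × Fin μ,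
        if Downward T (yNode ν μ) s(yNode ν μ, c) (sNode ν μ p.1 p.2) then (1 : ℝ) else 0) +
      ∑ q : Fin ν × Fin μ,
        if Downward T (yNode ν μ) s(yNode ν μ, c) (uNode ν μ q.1 q.2) then (μ : ℝ) ^ 2 else 0) := by
  have hy : ¬ Downward T (yNode ν μ) s(yNode ν μ, c) (Sum.inl 0) := not_downward_root
  rw [edgeFlow, Fintype.sum_sum_type, Fintype.sum_sum_type, Fin.sum_univ_two, if_neg hy, zero_add]
  simp [scDemand, zNode, sNode, uNode]
  rfl

/-- For every spanning tree `T` of the graph of the MDST instance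
produced by the forward mapping from a Set Cover instance, the dissipation cost
satisfies `C(T) ≥ d²`, where `d` is the number of nodes of `V_S` having degree at
least `2` in `T`. -/
theorem stmt12 (ν μ : ℕ) (hν : 1 ≤ ν) (Sets : Fin μ → Finset (Fin ν))
    (hcover : ∀ j : Fin ν, ∃ i : Fin μ, j ∈ Sets i)
    (T : SimpleGraph (SCNode ν μ)) (hT : IsSpanningTreeOf (scGraph ν μ Sets) T) :
    (({p : Fin μ × Fin μ | DegTwo T (sNode ν μ p.1 p.2)}.ncard : ℝ)) ^ 2 ≤
      scCost ν μ T := by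
  obtain ⟨hle, htree⟩ := hT
  set D : Set (Fin μ × Fin μ) := {p | DegTwo T (sNode ν μ p.1 p.2)} with hD
  by_cases hA : ∃ c j l, T.Adj (yNode ν μ) c ∧
      Downward T (yNode ν μ) s(yNode ν μ, c) (uNode ν μ j l) ∧
      ¬ Downward T (yNode ν μ) s(yNode ν μ, c) (zNode ν μ)
  · obtain ⟨c, j, l, hc, hu, hz⟩ := hA
    refine le_trans ?_ (sq_edgeFlow_le_scCost htree hc)
    have hd : (D.ncard : ℝ) ≤ (μ : ℝ) ^ 2 := by
      have := Set.ncard_le_card D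
      simp only [Nat.card_eq_fintype_card, Fintype.card_prod, Fintype.card_fin] at this
      rw [sq]
      exact_mod_cast this
    have hsum := Finset.single_le_sum
      (f := fun q : Fin ν × Fin μ =>
        if Downward T (yNode ν μ) s(yNode ν μ, c) (uNode ν μ q.1 q.2) then (μ : ℝ) ^ 2 else 0)
      (fun q _ => by split_ifs <;> positivity) (Finset.mem_univ (j, l))
    simp only [if_pos hu] at hsum
    have hs : (0 : ℝ) ≤ ∑ p : Fin μ × Fin μ,
        if Downward T (yNode ν μ) s(yNode ν μ, c) (sNode ν μ p.1 p.2) then (1 : ℝ) else 0 :=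
      Finset.sum_nonneg fun p _ => by split_ifs <;> norm_num
    rw [edgeFlow_root_branch, if_neg hz]
    gcongr
    linarith
  · push Not at hA
    obtain ⟨c, hc, hz⟩ := exists_adj_root_downward htree
      (show zNode ν μ ≠ yNode ν μ by simp [zNode, yNode])
    have hu : ∀ j l, Downward T (yNode ν μ) s(yNode ν μ, c) (uNode ν μ j l) := by
      intro j l
      obtain ⟨c', hc', hu'⟩ := exists_adj_root_downward htree
        (show uNode ν μ j l ≠ yNode ν μ by simp [uNode, yNode])
      rwa [root_branch_unique htree hz (hA c' j l hc' hu')]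
    have hs : ∀ p ∈ D, Downward T (yNode ν μ) s(yNode ν μ, c) (sNode ν μ p.1 p.2) := by
      intro p hp
      have hp' : 1 < {w | T.Adj (sNode ν μ p.1 p.2) w}.ncard := hp
      obtain ⟨w, hw, hwy⟩ := Set.exists_ne_of_one_lt_ncard hp' (yNode ν μ)
      have hsy : sNode ν μ p.1 p.2 ≠ yNode ν μ := by simp [sNode, yNode]
      rcases scGraph_sNode_adj (hle hw) with rfl | rfl | ⟨j, l, rfl⟩
      · exact absurd rfl hwy
      · exact hz.of_adj htree (SimpleGraph.Adj.symm hw) hsy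
      · exact (hu j l).of_adj htree (SimpleGraph.Adj.symm hw) hsy
    refine le_trans ?_ (sq_edgeFlow_le_scCost htree hc)
    have hcard : (D.ncard : ℝ) ≤ ∑ p : Fin μ × Fin μ,
        if Downward T (yNode ν μ) s(yNode ν μ, c) (sNode ν μ p.1 p.2) then (1 : ℝ) else 0 := by
      rw [Finset.sum_boole, Set.ncard_eq_toFinset_card']
      refine Nat.cast_le.2 (Finset.card_le_card fun p hp => ?_)
      simpa using hs p (by simpa using hp)
    rw [edgeFlow_root_branch, if_pos hz]
    simp only [hu, if_true, Finset.sum_const, Finset.card_univ, Fintype.card_prod,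
      Fintype.card_fin, nsmul_eq_mul, Nat.cast_mul]
    gcongr
    linarith
end

section
/- Let I be a Set Cover instance with universe U = {u_1, ..., u_nu} (nu >= 1) and collection of subsets S = {S_1, ..., S_mu} whose union is U, and let I' be the MDST instance produced from I by the forward mapping. Let OPT(I) be the minimum size of a set cover of U from S, and let OPT(I') be the minimum dissipation cost C(T) over all spanning trees T of the graph of I'. Then OPT(I') <= 2 * mu^2 * OPT(I)^2. -/
open SimpleGraph
open scoped Classical

/-- The optimum of the Set Cover instance: the minimum cardinality of a subcollection
covering the universe. -/
noncomputable def OPTsc (ν μ : ℕ) (Sets : Fin μ → Finset (Fin ν)) : ℕ :=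
  sInf {k : ℕ | ∃ x : Finset (Fin μ), (∀ j : Fin ν, ∃ i ∈ x, j ∈ Sets i) ∧ x.card = k}

/-- The optimum of the MDST instance produced by the forward mapping: the minimum
dissipation cost over all spanning trees of its graph. -/
noncomputable def OPTmdst (ν μ : ℕ) (Sets : Fin μ → Finset (Fin ν)) : ℝ :=
  sInf {c : ℝ | ∃ T : SimpleGraph (SCNode ν μ),
    IsSpanningTreeOf (scGraph ν μ Sets) T ∧ c = scCost ν μ T}

/-- The graph joining every node other than the root `r` to its parent under `p`. -/
def parentGraph {V : Type*} (p : V → V) (r : V) : SimpleGraph V :=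
  SimpleGraph.fromEdgeSet ((fun v => s(v, p v)) '' {r}ᶜ)

theorem parentGraph_adj {V : Type*} (p : V → V) (r a b : V) :
    (parentGraph p r).Adj a b ↔ a ≠ b ∧ ((a ≠ r ∧ b = p a) ∨ (b ≠ r ∧ a = p b)) := by
  simp only [parentGraph, SimpleGraph.fromEdgeSet_adj, Set.mem_image, Set.mem_compl_iff,
    Set.mem_singleton_iff, Sym2.eq_iff]
  constructor
  · rintro ⟨⟨v, hv, ⟨rfl, rfl⟩ | ⟨rfl, rfl⟩⟩, hne⟩
    · exact ⟨hne, Or.inl ⟨hv, rfl⟩⟩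
    · exact ⟨hne, Or.inr ⟨hv, rfl⟩⟩
  · rintro ⟨hne, ⟨ha, rfl⟩ | ⟨hb, rfl⟩⟩
    · exact ⟨⟨a, ha, Or.inl ⟨rfl, rfl⟩⟩, hne⟩
    · exact ⟨⟨b, hb, Or.inr ⟨rfl, rfl⟩⟩, hne⟩

theorem parentGraph_isTree {V : Type*} [Fintype V] (p : V → V) (r : V)
    (h : ∀ v, (parentGraph p r).Reachable r v) : (parentGraph p r).IsTree := by
  have hc : (parentGraph p r).Connected := by
    have : Nonempty V := ⟨r⟩
    exact ⟨fun a b => (h a).symm.trans (h b)⟩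
  refine SimpleGraph.isTree_iff_connected_and_card.mpr ⟨hc, le_antisymm ?_ ?_⟩
  · have h1 : (parentGraph p r).edgeSet ⊆ (fun v => s(v, p v)) '' {r}ᶜ := by
      simp [parentGraph, SimpleGraph.edgeSet_fromEdgeSet]
    have h2 := (Set.ncard_le_ncard h1 (Set.toFinite _)).trans
      (Set.ncard_image_le (Set.toFinite _))
    have h3 := Set.ncard_add_ncard_compl ({r} : Set V)
    rw [Set.ncard_singleton] at h3
    rw [Nat.card_coe_set_eq]
    omega
  · exact hc.card_vert_le_card_edgeSet_add_one

/-- `br` assigns to every node the child of the root `r` through which it is reached. -/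
structure IsBranch {V : Type*} (T : SimpleGraph V) (r : V) (br : V → V) : Prop where
  root : br r = r
  child : ∀ b, T.Adj r b → br b = b
  const : ∀ a b, T.Adj a b → a ≠ r → b ≠ r → br a = br b

namespace IsBranch

variable {V : Type*} {T : SimpleGraph V} {r : V} {br : V → V}

theorem mem_edges (hb : IsBranch T r br) {m : V} (hm : m ≠ r) {a u : V} (w : T.Walk a u)
    (ha : br a ≠ m) (hu : br u = m) : s(r, m) ∈ w.edges := by
  induction w with
  | nil => exact absurd hu ha
  | @cons a b u h q ih =>
    rw [SimpleGraph.Walk.edges_cons, List.mem_cons]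
    by_cases hbm : br b = m
    · left
      have hbr : b ≠ r := by
        rintro rfl
        exact hm (hbm.symm.trans hb.root)
      have har : a = r := by
        by_contra har
        exact ha ((hb.const a b h har hbr).trans hbm)
      subst har
      rw [← hbm, hb.child b h]
    · exact Or.inr (ih hbm hu)

theorem eq_of_walk (hb : IsBranch T r br) {a u : V} (w : T.Walk a u)
    (h : r ∉ w.support) : br a = br u := by
  induction w with
  | nil => rfl
  | @cons a b u hab q ih =>
    rw [SimpleGraph.Walk.support_cons, List.mem_cons, not_or] at h
    refine (hb.const a b hab (Ne.symm h.1) ?_).trans (ih h.2)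
    rintro rfl
    exact h.2 q.start_mem_support

theorem downward_iff (hb : IsBranch T r br) (hT : T.Connected) {m : V} (hm : m ≠ r) (u : V) :
    Downward T r s(r, m) u ↔ br u = m := by
  constructor
  · intro h
    obtain ⟨w, hw⟩ := (hT r u).exists_isPath
    have he := h w hw
    cases w with
    | nil => simp at he
    | @cons _ b _ hab q =>
      rw [SimpleGraph.Walk.cons_isPath_iff] at hw
      rw [SimpleGraph.Walk.edges_cons, List.mem_cons] at he
      rcases he with he | he
      · rw [Sym2.congr_right] at he
        subst he
        rw [← hb.eq_of_walk q hw.2, hb.child _ hab]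
      · exact absurd (q.fst_mem_support_of_mem_edges he) hw.2
  · intro h w _
    exact hb.mem_edges hm w (by rw [hb.root]; exact hm.symm) h

theorem edgeFlow_eq [Fintype V] (hb : IsBranch T r br) (hT : T.Connected) {m : V}
    (hm : m ≠ r) (f : V → ℝ) :
    edgeFlow T r f r m = ∑ u, if br u = m then f u else 0 := by
  simp only [edgeFlow, hb.downward_iff hT hm]

end IsBranch

theorem not_orientedEdge_root {V : Type*} (T : SimpleGraph V) (r a : V) :
    ¬ OrientedEdge T r a r := by
  rintro ⟨_, h⟩
  simpa using h SimpleGraph.Walk.nil SimpleGraph.Walk.IsPath.nil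

theorem scCost_eq (ν μ : ℕ) (T : SimpleGraph (SCNode ν μ)) :
    scCost ν μ T = ∑ b, if T.Adj (yNode ν μ) b ∧ OrientedEdge T (yNode ν μ) (yNode ν μ) b then
      edgeFlow T (yNode ν μ) (scDemand ν μ) (yNode ν μ) b ^ 2 else 0 := by
  rw [scCost, treeCost, Fintype.sum_prod_type, Finset.sum_eq_single (yNode ν μ)]
  · refine Finset.sum_congr rfl fun b _ => ?_
    by_cases h : OrientedEdge T (yNode ν μ) (yNode ν μ) b
    · simp [h, h.1, scAlpha]
    · simp [h]
  · intro a _ ha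
    refine Finset.sum_eq_zero fun b _ => ?_
    by_cases hb : b = yNode ν μ
    · subst hb
      simp [not_orientedEdge_root]
    · simp [scAlpha, Ne.symm ha, Ne.symm hb]
  · simp

theorem scCost_nonneg (ν μ : ℕ) (T : SimpleGraph (SCNode ν μ)) : 0 ≤ scCost ν μ T := by
  rw [scCost_eq]
  exact Finset.sum_nonneg fun b _ => by split_ifs <;> positivity

/-- The parent of each node in the spanning tree given by the cover `x`, where the element `j`
is covered by the set `c j`. -/
noncomputable def coverParent {ν μ : ℕ} (x : Finset (Fin μ)) (c : Fin ν → Fin μ) :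
    SCNode ν μ → SCNode ν μ
  | Sum.inl _ => yNode ν μ
  | Sum.inr (Sum.inl (i, _)) => if i ∈ x then zNode ν μ else yNode ν μ
  | Sum.inr (Sum.inr (j, l)) => sNode ν μ (c j) l

/-- The child of `y` above each node in the spanning tree given by the cover `x`. -/
noncomputable def coverBranch {ν μ : ℕ} (x : Finset (Fin μ)) : SCNode ν μ → SCNode ν μ
  | Sum.inl a => Sum.inl a
  | Sum.inr (Sum.inl (i, l)) => if i ∈ x then zNode ν μ else sNode ν μ i l
  | Sum.inr (Sum.inr _) => zNode ν μ

section CoverTree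

variable {ν μ : ℕ} (x : Finset (Fin μ)) (c : Fin ν → Fin μ)

theorem coverTree_isTree : (parentGraph (coverParent x c) (yNode ν μ)).IsTree := by
  have step : ∀ v, v ≠ yNode ν μ → coverParent x c v ≠ v →
      (parentGraph (coverParent x c) (yNode ν μ)).Reachable (yNode ν μ) (coverParent x c v) →
      (parentGraph (coverParent x c) (yNode ν μ)).Reachable (yNode ν μ) v := by
    intro v hv hne h
    refine h.trans (SimpleGraph.Adj.reachable ?_)
    exact (parentGraph_adj _ _ _ _).mpr ⟨hne, Or.inr ⟨hv, rfl⟩⟩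
  have hy : (parentGraph (coverParent x c) (yNode ν μ)).Reachable (yNode ν μ) (yNode ν μ) :=
    SimpleGraph.Reachable.refl _
  have hz : (parentGraph (coverParent x c) (yNode ν μ)).Reachable (yNode ν μ) (zNode ν μ) :=
    step _ (by simp [yNode, zNode]) (by simp [coverParent, yNode, zNode]) hy
  have hs : ∀ i l, (parentGraph (coverParent x c) (yNode ν μ)).Reachable (yNode ν μ)
      (sNode ν μ i l) := by
    intro i l
    by_cases hi : i ∈ x
    · refine step _ (by simp [yNode, sNode]) (by simp [coverParent, hi, zNode, sNode]) ?_
      simpa [coverParent, hi, sNode] using hz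
    · refine step _ (by simp [yNode, sNode]) (by simp [coverParent, hi, yNode, sNode]) ?_
      simp [coverParent, hi, sNode]
  refine parentGraph_isTree _ _ ?_
  rintro (a | ⟨i, l⟩ | ⟨j, l⟩)
  · fin_cases a
    · exact hy
    · exact hz
  · exact hs i l
  · exact step _ (by simp [yNode]) (by simp [coverParent, sNode]) (hs (c j) l)

theorem coverTree_le (Sets : Fin μ → Finset (Fin ν)) (hc : ∀ j, j ∈ Sets (c j)) :
    parentGraph (coverParent x c) (yNode ν μ) ≤ scGraph ν μ Sets := by
  refine SimpleGraph.fromEdgeSet_mono ?_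
  rintro _ ⟨v, hv, rfl⟩
  rcases v with a | ⟨i, l⟩ | ⟨j, l⟩
  · left; left
    fin_cases a
    · exact absurd rfl hv
    · exact Sym2.eq_swap
  · left; right
    refine ⟨i, l, ?_⟩
    by_cases hi : i ∈ x
    · right
      simp only [coverParent, hi, if_true]
      exact Sym2.eq_swap
    · left
      simp only [coverParent, hi, if_false]
      exact Sym2.eq_swap
  · right
    exact ⟨c j, l, j, hc j, Sym2.eq_swap⟩

theorem coverBranch_isBranch (hx : ∀ j, c j ∈ x) :
    IsBranch (parentGraph (coverParent x c) (yNode ν μ)) (yNode ν μ) (coverBranch x) := by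
  have key : ∀ v, v ≠ yNode ν μ →
      (coverParent x c v = yNode ν μ → coverBranch x v = v) ∧
      (coverParent x c v ≠ yNode ν μ → coverBranch x v = coverBranch x (coverParent x c v)) := by
    rintro (a | ⟨i, l⟩ | ⟨j, l⟩) hv
    · simp [coverParent, coverBranch]
    · by_cases hi : i ∈ x <;> simp [coverParent, coverBranch, hi, yNode, zNode, sNode]
    · simp [coverParent, coverBranch, hx, yNode, sNode]
  refine ⟨rfl, fun b h => ?_, fun a b h ha hb => ?_⟩
  · rw [parentGraph_adj] at h
    rcases h.2 with ⟨h1, _⟩ | ⟨h1, h2⟩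
    · exact absurd rfl h1
    · exact (key b h1).1 h2.symm
  · rw [parentGraph_adj] at h
    rcases h.2 with ⟨_, rfl⟩ | ⟨_, rfl⟩
    · exact (key a ha).2 hb
    · exact ((key b hb).2 ha).symm

theorem coverTree_flow_z (hx : ∀ j, c j ∈ x) :
    edgeFlow (parentGraph (coverParent x c) (yNode ν μ)) (yNode ν μ) (scDemand ν μ) (yNode ν μ)
      (zNode ν μ) = x.card * μ := by
  rw [(coverBranch_isBranch x c hx).edgeFlow_eq (coverTree_isTree x c).1 (by simp [yNode, zNode])]
  have hs : ∀ i l, (if (if i ∈ x then zNode ν μ else sNode ν μ i l) = zNode ν μ then (1 : ℝ)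
      else 0) = if i ∈ x then 1 else 0 := by
    intro i l
    by_cases hi : i ∈ x <;> simp [hi, sNode, zNode]
  simp only [Fintype.sum_sum_type, Fintype.sum_prod_type, Fin.sum_univ_two, coverBranch, scDemand,
    hs]
  simp [zNode]
  ring

theorem coverTree_flow_s (hx : ∀ j, c j ∈ x) {i : Fin μ} (hi : i ∉ x) (l : Fin μ) :
    edgeFlow (parentGraph (coverParent x c) (yNode ν μ)) (yNode ν μ) (scDemand ν μ) (yNode ν μ)
      (sNode ν μ i l) = 1 := by
  rw [(coverBranch_isBranch x c hx).edgeFlow_eq (coverTree_isTree x c).1 (by simp [yNode, sNode]),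
    Finset.sum_eq_single (sNode ν μ i l)]
  · simp [coverBranch, sNode, hi, scDemand]
  · rintro (a | ⟨i', l'⟩ | ⟨j, l'⟩) _ hne
    · simp [coverBranch, sNode]
    · by_cases hi' : i' ∈ x
      · simp [coverBranch, sNode, zNode, hi']
      · simp only [coverBranch, hi', if_false]
        exact if_neg hne
    · simp [coverBranch, sNode, zNode]
  · simp

theorem coverTree_cost_le (hx : ∀ j, c j ∈ x) :
    scCost ν μ (parentGraph (coverParent x c) (yNode ν μ)) ≤
      ((x.card : ℝ) * μ) ^ 2 + (μ : ℝ) ^ 2 := by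
  have hle : ∀ b : SCNode ν μ,
      (if (parentGraph (coverParent x c) (yNode ν μ)).Adj (yNode ν μ) b ∧
        OrientedEdge (parentGraph (coverParent x c) (yNode ν μ)) (yNode ν μ) (yNode ν μ) b then
        edgeFlow (parentGraph (coverParent x c) (yNode ν μ)) (yNode ν μ) (scDemand ν μ)
          (yNode ν μ) b ^ 2 else 0) ≤
      Sum.elim (fun a => if a = 0 then 0 else ((x.card : ℝ) * μ) ^ 2)
        (Sum.elim (fun _ => 1) (fun _ => 0)) b := by
    intro b
    split_ifs with h
    · have hadj := (parentGraph_adj _ _ _ _).mp h.1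
      have hb := (coverBranch_isBranch x c hx).child b h.1
      rcases b with a | ⟨i, l⟩ | ⟨j, l⟩
      · fin_cases a
        · exact absurd rfl hadj.1
        · have := coverTree_flow_z x c hx
          rw [zNode] at this
          simp [this]
      · have hi : i ∉ x := by
          intro hi
          simp [coverBranch, hi, zNode] at hb
        have := coverTree_flow_s x c hx hi l
        rw [sNode] at this
        simp [this]
      · simp [coverBranch, zNode] at hb
    · rcases b with a | b | b
      · simp only [Sum.elim_inl]
        split_ifs <;> positivity
      · simp
      · simp
  rw [scCost_eq]
  refine (Finset.sum_le_sum fun b _ => hle b).trans (le_of_eq ?_)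
  simp [Fintype.sum_sum_type, sq]

end CoverTree

/-- For every Set Cover instance `I` and the MDST instance `I'`
produced from it by the forward mapping, `OPT(I') ≤ 2 μ² OPT(I)²`. -/
theorem stmt13 (ν μ : ℕ) (hν : 1 ≤ ν) (Sets : Fin μ → Finset (Fin ν))
    (hcover : ∀ j : Fin ν, ∃ i : Fin μ, j ∈ Sets i) :
    OPTmdst ν μ Sets ≤ 2 * (μ : ℝ) ^ 2 * (OPTsc ν μ Sets : ℝ) ^ 2 := by
  obtain ⟨x, hx, hk⟩ : ∃ x : Finset (Fin μ), (∀ j : Fin ν, ∃ i ∈ x, j ∈ Sets i) ∧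
      x.card = OPTsc ν μ Sets :=
    Nat.sInf_mem (s := {k : ℕ | ∃ x : Finset (Fin μ),
      (∀ j : Fin ν, ∃ i ∈ x, j ∈ Sets i) ∧ x.card = k})
      ⟨_, Finset.univ, fun j => (hcover j).imp fun i hi => ⟨Finset.mem_univ i, hi⟩, rfl⟩
  choose c hcx hc using hx
  have hpos : 1 ≤ x.card := Finset.card_pos.mpr ⟨_, hcx ⟨0, hν⟩⟩
  have hbdd : BddBelow {r : ℝ | ∃ T : SimpleGraph (SCNode ν μ),
      IsSpanningTreeOf (scGraph ν μ Sets) T ∧ r = scCost ν μ T} := by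
    refine ⟨0, ?_⟩
    rintro _ ⟨T, _, rfl⟩
    exact scCost_nonneg ν μ T
  refine (csInf_le hbdd ⟨_, ⟨coverTree_le x c Sets hc, coverTree_isTree x c⟩, rfl⟩).trans
    ((coverTree_cost_le x c hcx).trans ?_)
  rw [← hk]
  have h1 : (1 : ℝ) ≤ x.card := by exact_mod_cast hpos
  have h2 : (μ : ℝ) ^ 2 * 1 ≤ (μ : ℝ) ^ 2 * (x.card : ℝ) ^ 2 := by
    gcongr
    exact one_le_pow₀ h1
  linarith [mul_pow (x.card : ℝ) (μ : ℝ) 2]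
end
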